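/- arXiv:2304.14555 — 2 statements merged into one kernel-verified Lean document; each statement's English description precedes it below -/
import Mathlib

section
/- Let p ≥ 5 be a prime and ω a character of ℚ_p^× with conductor a(ω) = N ≥ 1. If N > 1, or if N = 1 and the restriction of ω to ℤ_p^× has order greater than 3, then a(ω) + a(ω²) + a(ω³) = 3N; otherwise (N = 1 and the restriction of ω to ℤ_p^× has order 2 or 3) a(ω) + a(ω²) + a(ω³) = 3N − 1. -/
noncomputable section

/-- `IsTrivOn p χ n` says that the character `χ` of `ℚ_p^×` is trivial on the subgroup
`U^n`, where `U^0 = ℤ_p^×` and `U^n = 1 + p^n ℤ_p` for `n ≥ 1`. -/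
def IsTrivOn (p : ℕ) [Fact p.Prime] (χ : (ℚ_[p])ˣ →* ℂˣ) (n : ℕ) : Prop :=
  if n = 0 then ∀ u : (ℚ_[p])ˣ, ‖(u : ℚ_[p])‖ = 1 → χ u = 1
  else ∀ u : (ℚ_[p])ˣ, (∃ z : ℤ_[p], (u : ℚ_[p]) = 1 + (p : ℚ_[p]) ^ n * (z : ℚ_[p])) → χ u = 1

/-- The conductor `a(χ)` of a character of `ℚ_p^×`: the smallest `n` such that `χ` is
trivial on `U^n`. -/
def condQ (p : ℕ) [Fact p.Prime] (χ : (ℚ_[p])ˣ →* ℂˣ) : ℕ :=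
  sInf {n | IsTrivOn p χ n}

/-- The restriction of a character of `ℚ_p^×` to `ℤ_p^×`. -/
def restrQ (p : ℕ) [Fact p.Prime] (χ : (ℚ_[p])ˣ →* ℂˣ) : (ℤ_[p])ˣ →* ℂˣ :=
  χ.comp (Units.map (PadicInt.Coe.ringHom.toMonoidHom))

theorem isTrivOn_zero_iff {p : ℕ} [Fact p.Prime] {χ : (ℚ_[p])ˣ →* ℂˣ} :
    IsTrivOn p χ 0 ↔ restrQ p χ = 1 := by
  simp only [IsTrivOn, if_true]
  constructor
  · intro h
    ext1 u
    exact h _ (PadicInt.norm_units u)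
  · intro h u hu
    let v : (ℤ_[p])ˣ := PadicInt.mkUnits hu
    have hv : Units.map (PadicInt.Coe.ringHom.toMonoidHom) v = u := Units.ext rfl
    rw [← hv]
    exact DFunLike.congr_fun h v

theorem isTrivOn_iff_of_pos {p : ℕ} [Fact p.Prime] {χ : (ℚ_[p])ˣ →* ℂˣ} {n : ℕ} (hn : 1 ≤ n) :
    IsTrivOn p χ n ↔ ∀ u : (ℚ_[p])ˣ,
      (∃ z : ℤ_[p], (u : ℚ_[p]) = 1 + (p : ℚ_[p]) ^ n * (z : ℚ_[p])) → χ u = 1 := by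
  rw [IsTrivOn, if_neg (by lia)]

theorem norm_eq_one_of_eq_one_add {p : ℕ} [Fact p.Prime] {n : ℕ} (hn : 1 ≤ n) (z : ℤ_[p]) :
    ‖(1 + (p : ℚ_[p]) ^ n * (z : ℚ_[p]))‖ = 1 := by
  have hp : (1 : ℝ) < p := by exact_mod_cast (Fact.out : p.Prime).one_lt
  have hlt : ‖(p : ℚ_[p]) ^ n * (z : ℚ_[p])‖ < 1 := by
    rw [norm_mul, norm_pow]
    exact mul_lt_one_of_nonneg_of_lt_one_left (by positivity)
      (pow_lt_one₀ (norm_nonneg _) Padic.norm_p_lt_one (by lia)) z.2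
  rw [Padic.add_eq_max_of_ne (by rw [norm_one]; exact hlt.ne'), norm_one, max_eq_left hlt.le]

theorem IsTrivOn.mono {p : ℕ} [Fact p.Prime] {χ : (ℚ_[p])ˣ →* ℂˣ} {m n : ℕ} (hmn : m ≤ n)
    (h : IsTrivOn p χ m) : IsTrivOn p χ n := by
  rcases Nat.eq_zero_or_pos n with rfl | hn
  · rwa [Nat.le_zero.mp hmn] at h
  rw [isTrivOn_iff_of_pos hn]
  rintro u ⟨z, hz⟩
  rcases Nat.eq_zero_or_pos m with rfl | hm
  · simp only [IsTrivOn, if_true] at h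
    exact h u (by rw [hz]; exact norm_eq_one_of_eq_one_add hn z)
  · refine (isTrivOn_iff_of_pos hm).mp h u ⟨p ^ (n - m) * z, ?_⟩
    obtain ⟨d, rfl⟩ := Nat.exists_eq_add_of_le hmn
    rw [hz, Nat.add_sub_cancel_left]
    push_cast
    ring

theorem IsTrivOn.pow {p : ℕ} [Fact p.Prime] {χ : (ℚ_[p])ˣ →* ℂˣ} {n : ℕ}
    (h : IsTrivOn p χ n) (k : ℕ) : IsTrivOn p (χ ^ k) n := by
  unfold IsTrivOn at h ⊢
  split_ifs at h ⊢ <;> intro u hu <;> rw [MonoidHom.pow_apply, h u hu, one_pow]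

/-- Raising to the power `p ^ m` sends `U^1` into `U^(m+1)`. -/
theorem exists_pow_eq_one_add {p : ℕ} [Fact p.Prime] {n : ℕ} (hn : 1 ≤ n) (z : ℤ_[p]) (m : ℕ) :
    ∃ w : ℤ_[p], (1 + (p : ℚ_[p]) ^ n * (z : ℚ_[p])) ^ p ^ m =
      1 + (p : ℚ_[p]) ^ (m + 1) * (w : ℚ_[p]) := by
  have hdvd : (p : ℤ_[p]) ∣ (1 + (p : ℤ_[p]) ^ n * z) - 1 := by
    rw [add_sub_cancel_left]
    exact (dvd_pow_self _ (by lia)).mul_right z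
  obtain ⟨w, hw⟩ := dvd_sub_pow_of_dvd_sub hdvd m
  refine ⟨w, ?_⟩
  rw [one_pow, sub_eq_iff_eq_add'] at hw
  exact_mod_cast congrArg (fun x : ℤ_[p] => (x : ℚ_[p])) hw

/-- Since `U^n` is pro-`p` for `n ≥ 1`, a power prime to `p` detects triviality on it. -/
theorem IsTrivOn.of_pow {p : ℕ} [Fact p.Prime] {χ : (ℚ_[p])ˣ →* ℂˣ}
    (hfin : ∃ n, IsTrivOn p χ n) {k n : ℕ} (hk : p.Coprime k) (hn : 1 ≤ n)
    (h : IsTrivOn p (χ ^ k) n) : IsTrivOn p χ n := by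
  obtain ⟨m, hm⟩ := hfin
  have hm' := (isTrivOn_iff_of_pos (Nat.le_add_left 1 m)).mp (hm.mono (Nat.le_add_right m 1))
  rw [isTrivOn_iff_of_pos hn] at h ⊢
  rintro u ⟨z, hz⟩
  have hpow : χ u ^ p ^ m = 1 := by
    rw [← map_pow]
    refine hm' _ ?_
    rw [Units.val_pow_eq_pow_val, hz]
    exact exists_pow_eq_one_add hn z m
  have hcop : (p ^ m).gcd k = 1 := hk.pow_left m
  have hgcd := pow_gcd_eq_one.mpr ⟨hpow, h u ⟨z, hz⟩⟩
  rwa [hcop, pow_one] at hgcd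

theorem condQ_pow_of_restrQ_pow_ne_one {p : ℕ} [Fact p.Prime] {χ : (ℚ_[p])ˣ →* ℂˣ}
    (hfin : ∃ n, IsTrivOn p χ n) {k : ℕ} (hk : p.Coprime k) (h : restrQ p χ ^ k ≠ 1) :
    condQ p (χ ^ k) = condQ p χ := by
  have hiff (n : ℕ) : IsTrivOn p (χ ^ k) n ↔ IsTrivOn p χ n := by
    refine ⟨fun hχ => ?_, fun hχ => hχ.pow k⟩
    rcases Nat.eq_zero_or_pos n with rfl | hn
    · exact absurd (isTrivOn_zero_iff.mp hχ) h
    · exact hχ.of_pow hfin hk hn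
  simp only [condQ, hiff]

theorem condQ_eq_zero_of_restrQ_eq_one {p : ℕ} [Fact p.Prime] {χ : (ℚ_[p])ˣ →* ℂˣ}
    (h : restrQ p χ = 1) : condQ p χ = 0 :=
  Nat.sInf_eq_zero.mpr (Or.inl (isTrivOn_zero_iff.mpr h))

theorem condQ_le_one_of_restrQ_pow_eq_one {p : ℕ} [Fact p.Prime] {χ : (ℚ_[p])ˣ →* ℂˣ}
    (hfin : ∃ n, IsTrivOn p χ n) {k : ℕ} (hk : p.Coprime k) (h : restrQ p χ ^ k = 1) :
    condQ p χ ≤ 1 := by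
  have h₀ : IsTrivOn p (χ ^ k) 0 := isTrivOn_zero_iff.mpr h
  exact Nat.sInf_le ((h₀.mono zero_le_one).of_pow hfin hk le_rfl)

/-- For a prime `p ≥ 5` and a character `ω` of `ℚ_p^×` of conductor `N ≥ 1`:
if `N > 1`, or `N = 1` and the restriction of `ω` to `ℤ_p^×` has order `> 3`, then
`a(ω) + a(ω²) + a(ω³) = 3N`; otherwise (`N = 1` and that order is `2` or `3`) the
sum is `3N - 1`. -/
theorem conductor_sum_principal_series (p : ℕ) [Fact p.Prime] (hp : 5 ≤ p)
    (ω : (ℚ_[p])ˣ →* ℂˣ) (hfin : ∃ n, IsTrivOn p ω n)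
    (N : ℕ) (hN : condQ p ω = N) (hN1 : 1 ≤ N) :
    ((1 < N ∨ (N = 1 ∧ 3 < orderOf (restrQ p ω))) →
      condQ p ω + condQ p (ω ^ 2) + condQ p (ω ^ 3) = 3 * N) ∧
    ((N = 1 ∧ (orderOf (restrQ p ω) = 2 ∨ orderOf (restrQ p ω) = 3)) →
      condQ p ω + condQ p (ω ^ 2) + condQ p (ω ^ 3) = 3 * N - 1) := by
  have hcop {k : ℕ} (hk : 0 < k) (hk5 : k < 5) : p.Coprime k :=
    Nat.coprime_of_lt_prime hk.ne' (by lia) Fact.out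
  have h2 : p.Coprime 2 := hcop (by lia) (by lia)
  have h3 : p.Coprime 3 := hcop (by lia) (by lia)
  constructor
  · intro h
    have hne {k : ℕ} (hk : 0 < k) (hk3 : k ≤ 3) : restrQ p ω ^ k ≠ 1 := by
      intro hω
      rcases h with h | ⟨-, h⟩
      · have := condQ_le_one_of_restrQ_pow_eq_one hfin (hcop hk (by lia)) hω
        lia
      · have := orderOf_le_of_pow_eq_one (x := restrQ p ω) hk hω
        lia
    rw [condQ_pow_of_restrQ_pow_ne_one hfin h2 (hne (by lia) (by lia)),
      condQ_pow_of_restrQ_pow_ne_one hfin h3 (hne (by lia) (by lia))]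
    lia
  · rintro ⟨hN', h | h⟩
    · have hω2 : restrQ p (ω ^ 2) = 1 := orderOf_dvd_iff_pow_eq_one.mp h.dvd
      have hω3 : restrQ p ω ^ 3 ≠ 1 := by
        rw [Ne, ← orderOf_dvd_iff_pow_eq_one, h]
        norm_num
      rw [condQ_eq_zero_of_restrQ_eq_one hω2, condQ_pow_of_restrQ_pow_ne_one hfin h3 hω3]
      lia
    · have hω3 : restrQ p (ω ^ 3) = 1 := orderOf_dvd_iff_pow_eq_one.mp h.dvd
      have hω2 : restrQ p ω ^ 2 ≠ 1 := by
        rw [Ne, ← orderOf_dvd_iff_pow_eq_one, h]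
        norm_num
      rw [condQ_eq_zero_of_restrQ_eq_one hω3, condQ_pow_of_restrQ_pow_ne_one hfin h2 hω2]
      lia
end
end

section
/- Let ω be a character of ℚ₂^× with conductor a(ω) = N ≥ 1 (necessarily N ≥ 2). Then a(ω) + a(ω²) + a(ω³) = 2N if N ∈ {2, 3}, and a(ω) + a(ω²) + a(ω³) = 3N − 1 if N > 3. -/
noncomputable section

theorem isTrivOn_two_iff (χ : (ℚ_[2])ˣ →* ℂˣ) {n : ℕ} (hn : n ≠ 0) :
    IsTrivOn 2 χ n ↔ ∀ u : (ℚ_[2])ˣ, (∃ z : ℤ_[2], (u : ℚ_[2]) = 1 + 2 ^ n * (z : ℚ_[2])) →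
      χ u = 1 := by
  simp [IsTrivOn, hn]

theorem PadicInt.coe_two_eq_two : ((2 : ℤ_[2]) : ℚ_[2]) = 2 := rfl

theorem PadicInt.two_dvd_or_two_dvd_sub_one (x : ℤ_[2]) : 2 ∣ x ∨ 2 ∣ x - 1 := by
  have h := x.norm_sub_zmodRepr_lt_one
  have h2 := x.zmodRepr_lt_p
  rw [PadicInt.norm_lt_one_iff_dvd] at h
  have : x.zmodRepr = 0 ∨ x.zmodRepr = 1 := by omega
  rcases this with h0 | h0 <;> rw [h0] at h
  · left; simpa using h
  · right; simpa using h

theorem exists_eq_one_add_two_mul_of_norm_eq_one {u : ℚ_[2]} (hu : ‖u‖ = 1) :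
    ∃ z : ℤ_[2], u = 1 + 2 * (z : ℚ_[2]) := by
  obtain ⟨x, rfl⟩ : ∃ x : ℤ_[2], (x : ℚ_[2]) = u := ⟨⟨u, hu.le⟩, rfl⟩
  rcases PadicInt.two_dvd_or_two_dvd_sub_one x with h | ⟨z, hz⟩
  · have h1 : ‖x‖ < 1 := (PadicInt.norm_lt_one_iff_dvd x).2 (by simpa using h)
    exact absurd hu h1.ne
  · refine ⟨z, ?_⟩
    rw [← PadicInt.coe_two_eq_two, ← PadicInt.coe_mul, ← hz]
    push_cast
    ring

theorem isTrivOn_two_zero_of_one {χ : (ℚ_[2])ˣ →* ℂˣ} (h : IsTrivOn 2 χ 1) :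
    IsTrivOn 2 χ 0 := by
  rw [isTrivOn_two_iff χ one_ne_zero] at h
  simp only [IsTrivOn, if_true]
  intro u hu
  obtain ⟨z, hz⟩ := exists_eq_one_add_two_mul_of_norm_eq_one hu
  exact h u ⟨z, by rw [hz, pow_one]⟩

theorem norm_eq_one_of_eq_one_add_two_pow_mul {u : ℚ_[2]} {n : ℕ} (hn : n ≠ 0) {z : ℤ_[2]}
    (h : u = 1 + 2 ^ n * (z : ℚ_[2])) : ‖u‖ = 1 := by
  have hlt : ‖(2 : ℤ_[2]) ^ n * z‖ < 1 := by
    rw [PadicInt.norm_lt_one_iff_dvd]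
    exact Dvd.dvd.mul_right (dvd_pow (by simp) hn) z
  have hlt' : ‖(2 : ℚ_[2]) ^ n * (z : ℚ_[2])‖ < 1 := by
    have h := hlt
    rw [PadicInt.norm_def] at h
    push_cast at h
    exact h
  rw [h, Padic.add_eq_max_of_ne]
  · simpa using hlt'.le
  · simpa using hlt'.ne'

theorem IsTrivOn.mono_two {χ : (ℚ_[2])ˣ →* ℂˣ} {m n : ℕ} (hmn : m ≤ n)
    (h : IsTrivOn 2 χ m) : IsTrivOn 2 χ n := by
  rcases eq_or_ne n 0 with rfl | hn
  · rwa [Nat.le_zero.1 hmn] at h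
  rw [isTrivOn_two_iff χ hn]
  rintro u ⟨z, hz⟩
  rcases eq_or_ne m 0 with rfl | hm
  · simp only [IsTrivOn, if_true] at h
    exact h u (norm_eq_one_of_eq_one_add_two_pow_mul hn hz)
  · rw [isTrivOn_two_iff χ hm] at h
    refine h u ⟨2 ^ (n - m) * z, ?_⟩
    push_cast
    rw [PadicInt.coe_two_eq_two, hz, ← mul_assoc, ← pow_add, Nat.add_sub_cancel' hmn]

theorem condQ_two_eq_of_isTrivOn {χ : (ℚ_[2])ˣ →* ℂˣ} {n : ℕ} (h : IsTrivOn 2 χ (n + 1))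
    (h' : ¬ IsTrivOn 2 χ n) : condQ 2 χ = n + 1 := by
  refine le_antisymm (Nat.sInf_le h) ?_
  by_contra! hlt
  have hmem : IsTrivOn 2 χ (condQ 2 χ) :=
    Nat.sInf_mem (s := {n | IsTrivOn 2 χ n}) ⟨n + 1, h⟩
  exact h' (hmem.mono_two (by omega))

theorem isTrivOn_two_sq {χ : (ℚ_[2])ˣ →* ℂˣ} {n : ℕ} (hn : 1 ≤ n)
    (h : IsTrivOn 2 χ (n + 2)) : IsTrivOn 2 (χ ^ 2) (n + 1) := by
  rw [isTrivOn_two_iff _ (by omega)] at h ⊢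
  rintro u ⟨z, hz⟩
  rw [MonoidHom.pow_apply, ← map_pow]
  obtain ⟨k, rfl⟩ := Nat.exists_eq_add_of_le' hn
  refine h _ ⟨z + 2 ^ (k + 1) * z ^ 2, ?_⟩
  push_cast
  rw [PadicInt.coe_two_eq_two, hz]
  ring

theorem isTrivOn_two_sq_zero {χ : (ℚ_[2])ˣ →* ℂˣ} (h : IsTrivOn 2 χ 3) :
    IsTrivOn 2 (χ ^ 2) 0 := by
  rw [isTrivOn_two_iff _ (by omega)] at h
  simp only [IsTrivOn, if_true]
  intro u hu
  obtain ⟨z, hz⟩ := exists_eq_one_add_two_mul_of_norm_eq_one hu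
  rw [MonoidHom.pow_apply, ← map_pow]
  have hdvd : (2 : ℤ_[2]) ∣ z * (z + 1) := by
    rcases PadicInt.two_dvd_or_two_dvd_sub_one z with h | h
    · exact h.mul_right _
    · refine Dvd.dvd.mul_left ?_ _
      have := dvd_add h (dvd_refl 2)
      rwa [show z - 1 + 2 = z + 1 by ring] at this
  obtain ⟨w, hw⟩ := hdvd
  refine h _ ⟨w, ?_⟩
  have := congrArg (fun x : ℤ_[2] => (x : ℚ_[2])) hw
  push_cast at this ⊢
  rw [PadicInt.coe_two_eq_two] at this
  rw [hz]
  linear_combination 4 * this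

theorem PadicInt.exists_add_two_pow_mul_sq_eq (k : ℕ) (w : ℤ_[2]) :
    ∃ z : ℤ_[2], z + 2 ^ (k + 1) * z ^ 2 = w := by
  open Polynomial in
  let F : ℤ_[2][X] := X + C (2 ^ (k + 1)) * X ^ 2 - C w
  have hF (x : ℤ_[2]) : F.aeval x = x + 2 ^ (k + 1) * x ^ 2 - w := by
    simp [F]
  have hF' (x : ℤ_[2]) : F.derivative.aeval x = 1 + 2 ^ (k + 1) * (2 * x) := by
    simp only [F, derivative_sub, derivative_add, derivative_X, derivative_C_mul,
      derivative_X_pow, derivative_C]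
    simp
  have hlt (y : ℤ_[2]) : ‖(2 : ℤ_[2]) ^ (k + 1) * y‖ < 1 := by
    rw [PadicInt.norm_lt_one_iff_dvd]
    exact Dvd.dvd.mul_right (dvd_pow (by simp) k.succ_ne_zero) y
  have hone : ‖F.derivative.aeval w‖ = 1 := by
    rw [hF', PadicInt.norm_add_eq_max_of_ne]
    · simpa using (hlt (2 * w)).le
    · simpa using (hlt (2 * w)).ne'
  obtain ⟨z, hz, -⟩ := hensels_lemma (F := F) (a := w) (by
    rw [hone, hF, add_sub_cancel_left, one_pow]
    exact hlt _)
  exact ⟨z, by rw [hF] at hz; exact sub_eq_zero.1 hz⟩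

theorem isTrivOn_two_of_sq {χ : (ℚ_[2])ˣ →* ℂˣ} {n : ℕ}
    (h : IsTrivOn 2 (χ ^ 2) (n + 2)) : IsTrivOn 2 χ (n + 3) := by
  rw [isTrivOn_two_iff _ (by omega)] at h ⊢
  rintro u ⟨w, hw⟩
  obtain ⟨z, hz⟩ := PadicInt.exists_add_two_pow_mul_sq_eq n w
  have hz' := congrArg (fun x : ℤ_[2] => (x : ℚ_[2])) hz
  push_cast at hz'
  rw [PadicInt.coe_two_eq_two] at hz'
  have hsq : (u : ℚ_[2]) = (1 + 2 ^ (n + 2) * (z : ℚ_[2])) ^ 2 := by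
    rw [hw, ← hz']
    ring
  have hne : 1 + 2 ^ (n + 2) * (z : ℚ_[2]) ≠ 0 := fun h0 => u.ne_zero (by rw [hsq, h0]; simp)
  have hu : u = Units.mk0 _ hne ^ 2 := by
    ext
    simpa using hsq
  rw [hu, map_pow, ← MonoidHom.pow_apply]
  exact h _ ⟨z, rfl⟩

theorem IsTrivOn.of_sq_of_cube {p : ℕ} [Fact p.Prime] {χ : (ℚ_[p])ˣ →* ℂˣ} {n : ℕ}
    (h2 : IsTrivOn p (χ ^ 2) n) (h3 : IsTrivOn p (χ ^ 3) n) : IsTrivOn p χ n := by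
  unfold IsTrivOn at h2 h3 ⊢
  split_ifs at h2 h3 ⊢ <;> intro u hu <;>
  · have a := h2 u hu
    have b := h3 u hu
    rw [MonoidHom.pow_apply] at a b
    rwa [pow_succ, a, one_mul] at b

/-- For a character `ω` of `ℚ₂^×` of conductor `N ≥ 1`: necessarily `N ≥ 2`, and
`a(ω) + a(ω²) + a(ω³) = 2N` if `N ∈ {2,3}`, while the sum is `3N - 1` if `N > 3`. -/
theorem conductor_sum_principal_series_two (ω : (ℚ_[2])ˣ →* ℂˣ)
    (hfin : ∃ n, IsTrivOn 2 ω n) (N : ℕ) (hN : condQ 2 ω = N) (hN1 : 1 ≤ N) :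
    2 ≤ N ∧
    ((N = 2 ∨ N = 3) → condQ 2 ω + condQ 2 (ω ^ 2) + condQ 2 (ω ^ 3) = 2 * N) ∧
    (3 < N → condQ 2 ω + condQ 2 (ω ^ 2) + condQ 2 (ω ^ 3) = 3 * N - 1) := by
  have htriv : IsTrivOn 2 ω N := hN ▸ Nat.sInf_mem (s := {n | IsTrivOn 2 ω n}) hfin
  have hmin {m : ℕ} (hm : IsTrivOn 2 ω m) : N ≤ m := hN ▸ Nat.sInf_le hm
  have hN2 : 2 ≤ N := by
    by_contra! hlt
    obtain rfl : N = 1 := by omega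
    exact absurd (hmin (isTrivOn_two_zero_of_one htriv)) (by omega)
  obtain ⟨M, rfl⟩ := Nat.exists_eq_add_of_le' hN2
  have hnot : ¬ IsTrivOn 2 ω (M + 1) := fun h => by have := hmin h; omega
  have hsq : IsTrivOn 2 (ω ^ 2) (M + 1) := by
    rcases Nat.eq_zero_or_pos M with rfl | hM
    · exact (isTrivOn_two_sq_zero (htriv.mono_two (by omega))).mono_two (by omega)
    · exact isTrivOn_two_sq hM htriv
  have hcube : condQ 2 (ω ^ 3) = M + 2 :=
    condQ_two_eq_of_isTrivOn (htriv.pow 3) fun h => hnot (hsq.of_sq_of_cube h)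
  refine ⟨hN2, fun h => ?_, fun h => ?_⟩
  · have h0 : condQ 2 (ω ^ 2) = 0 :=
      Nat.le_zero.1 (Nat.sInf_le (isTrivOn_two_sq_zero (htriv.mono_two (by omega))))
    omega
  · have h1 : condQ 2 (ω ^ 2) = M + 1 := by
      refine condQ_two_eq_of_isTrivOn hsq fun h' => ?_
      obtain ⟨K, rfl⟩ := Nat.exists_eq_add_of_le' (show 2 ≤ M by omega)
      exact hnot (isTrivOn_two_of_sq h')
    omega
end
end
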